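/- Let μ_x, μ_y > 0, L′_xx ≥ 0, L_yx > 0, L_yy ≥ 0, θ ∈ (0,1), τ, σ > 0 and π₁, π₂ > 0 satisfy the four inequalities: τ ≥ (1 − θ)/μ_x, σ ≥ (1 − θ)/(μ_y·θ), 1/τ ≥ L′_xx + π₁·L_yx, and 1/σ ≥ θ·L_yx/π₁ + (θ/π₂ + π₂)·L_yy. Then, with ρ = θ, L̄_xx = L′_xx and α = θ·L_yx/π₁ + θ·L_yy/π₂, the 5×5 matrix G(τ,σ,θ,α,ρ) is positive semidefinite. -/

import Mathlib

open Matrix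

/-- The 5×5 SAPD matrix `G(τ,σ,θ,α,ρ)`. -/
noncomputable def sapdG (τ σ θ α ρ μx μy Lbxx Lyx Lyy : ℝ) : Matrix (Fin 5) (Fin 5) ℝ :=
  !![1/τ * (1 - 1/ρ) + μx/ρ, 0, 0, 0, 0;
     0, 1/σ * (1 - 1/ρ) + μy, (θ/ρ - 1) * Lyx, (θ/ρ - 1) * Lyy, 0;
     0, (θ/ρ - 1) * Lyx, 1/τ - Lbxx, 0, -(θ/ρ) * Lyx;
     0, (θ/ρ - 1) * Lyy, 0, 1/σ - α, -(θ/ρ) * Lyy;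
     0, 0, -(θ/ρ) * Lyx, -(θ/ρ) * Lyy, α/ρ]

/-- Young's inequality with weight `p`. -/
theorem two_mul_mul_le_weighted_sq {p : ℝ} (hp : 0 < p) (a b : ℝ) :
    2 * (a * b) ≤ p * a ^ 2 + b ^ 2 / p := by
  have h : p * a ^ 2 + b ^ 2 / p - 2 * (a * b) = (p * a - b) ^ 2 / p := by
    field_simp
    ring
  have : 0 ≤ (p * a - b) ^ 2 / p := by positivity
  linarith

/-- With `ρ = θ`, the diagonal entries `(1/t)(1 - 1/θ) + m` are nonnegative once the step size `t`
is at least `(1 - θ)/(m θ)`. -/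
theorem one_div_mul_one_sub_one_div_add_nonneg {t m θ : ℝ} (ht : 0 < t) (hm : 0 < m) (hθ : 0 < θ)
    (h : (1 - θ) / (m * θ) ≤ t) : 0 ≤ 1 / t * (1 - 1 / θ) + m := by
  rw [div_le_iff₀ (by positivity)] at h
  have e : 1 / t * (1 - 1 / θ) + m = (t * (m * θ) - (1 - θ)) / (t * θ) := by
    field_simp
    ring
  rw [e]
  exact div_nonneg (by linarith) (by positivity)

/-- Sufficient scalar conditions for positive semidefiniteness of `G` with
`ρ = θ`, `L̄_xx = L′_xx` and `α = θ L_yx/π₁ + θ L_yy/π₂`. -/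
theorem sapdG_psd_of_scalar_conditions
    (μx μy L'xx Lyx Lyy θ τ σ π₁ π₂ : ℝ)
    (hμx : 0 < μx) (hμy : 0 < μy) (hL'xx : 0 ≤ L'xx) (hLyx : 0 < Lyx) (hLyy : 0 ≤ Lyy)
    (hθ0 : 0 < θ) (hθ1 : θ < 1) (hτ : 0 < τ) (hσ : 0 < σ) (hπ₁ : 0 < π₁) (hπ₂ : 0 < π₂)
    (h1 : τ ≥ (1 - θ) / μx)
    (h2 : σ ≥ (1 - θ) / (μy * θ))
    (h3 : 1/τ ≥ L'xx + π₁ * Lyx)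
    (h4 : 1/σ ≥ θ * Lyx / π₁ + (θ/π₂ + π₂) * Lyy) :
    ∀ v : Fin 5 → ℝ,
      0 ≤ v ⬝ᵥ (sapdG τ σ θ (θ * Lyx / π₁ + θ * Lyy / π₂) θ μx μy L'xx Lyx Lyy *ᵥ v) := by
  intro v
  have d1 : 0 ≤ 1 / τ * (1 - 1 / θ) + μx / θ :=
    one_div_mul_one_sub_one_div_add_nonneg hτ (by positivity) hθ0
      (by rwa [div_mul_cancel₀ _ hθ0.ne'])
  have d2 : 0 ≤ 1 / σ * (1 - 1 / θ) + μy :=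
    one_div_mul_one_sub_one_div_add_nonneg hσ hμy hθ0 h2
  have d3 : 0 ≤ 1 / τ - L'xx - π₁ * Lyx := by linarith
  have d4 : 0 ≤ 1 / σ - (θ * Lyx / π₁ + θ * Lyy / π₂) - π₂ * Lyy := by
    have e : (θ / π₂ + π₂) * Lyy = θ * Lyy / π₂ + π₂ * Lyy := by ring
    linarith
  have d5 : (θ * Lyx / π₁ + θ * Lyy / π₂) / θ = Lyx / π₁ + Lyy / π₂ := by
    field_simp
  have q1 := mul_nonneg d1 (sq_nonneg (v 0))
  have q2 := mul_nonneg d2 (sq_nonneg (v 1))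
  have q3 := mul_nonneg d3 (sq_nonneg (v 2))
  have q4 := mul_nonneg d4 (sq_nonneg (v 3))
  have y1 := mul_le_mul_of_nonneg_left (two_mul_mul_le_weighted_sq hπ₁ (v 2) (v 4)) hLyx.le
  have y2 := mul_le_mul_of_nonneg_left (two_mul_mul_le_weighted_sq hπ₂ (v 3) (v 4)) hLyy
  simp only [sapdG, d5, div_self hθ0.ne', dotProduct, mulVec, Fin.sum_univ_five, of_apply,
    cons_val]
  linear_combination q1 + q2 + q3 + q4 + y1 + y2
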